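/- arXiv:1705.04910 — 4 statements merged into one kernel-verified Lean document; each statement's English description precedes it below -/
import Mathlib

section
/- The intersection of the unit sphere of ℝ⁴ with (1/2)ℤ[τ]⁴ is exactly Δ ∪ Δ'; that is, a vector x ∈ ℝ⁴ satisfies |x| = 1 and 2x ∈ ℤ[τ]⁴ if and only if x ∈ Δ ∪ Δ'. -/
noncomputable section

/-- The golden ratio τ = (1+√5)/2. -/
def gr : ℝ := (1 + Real.sqrt 5) / 2

/-- The ring ℤ[τ] as a subset of ℝ. -/
def Ztau : Set ℝ := {x : ℝ | ∃ a b : ℤ, x = (a : ℝ) + (b : ℝ) * gr}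

/-- The H₄ root system with parameter t (t = τ gives Δ, t = 1-τ = τ' gives Δ'). -/
def DeltaSet (t : ℝ) : Set (Fin 4 → ℝ) :=
  {x | (∃ i, (x i = 1 ∨ x i = -1) ∧ ∀ j, j ≠ i → x j = 0)
    ∨ (∀ i, x i = 1/2 ∨ x i = -1/2)
    ∨ (∃ σ : Equiv.Perm (Fin 4), Equiv.Perm.sign σ = 1 ∧
        ∃ ε : Fin 4 → ℝ, (∀ i, ε i = 1 ∨ ε i = -1) ∧
          ∀ i, x i = ε i * (![0, 1, 1 - t, t] (σ i)) / 2)}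

theorem gr_sq : gr ^ 2 = gr + 1 := Real.goldenRatio_sq

theorem int_add_mul_gr_eq_zero {p q : ℤ} (h : (p : ℝ) + q * gr = 0) : p = 0 ∧ q = 0 := by
  have hq : q = 0 := by
    by_contra hq
    have hirr : Irrational ((p : ℝ) + q * gr) :=
      (Real.goldenRatio_irrational.intCast_mul hq).intCast_add p
    exact hirr.ne_zero h
  subst hq
  simpa using h

theorem neg_mem_Ztau {y : ℝ} (hy : y ∈ Ztau) : -y ∈ Ztau := by
  obtain ⟨a, b, rfl⟩ := hy
  exact ⟨-a, -b, by push_cast; ring⟩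

/-- Representatives up to sign of the pairs `(a, b)` of integers with `a ^ 2 + b ^ 2 ≤ 4`. -/
def shortPair : Fin 7 → ℤ × ℤ :=
  ![(0, 0), (1, 0), (0, 1), (1, 1), (1, -1), (2, 0), (0, 2)]

/-- The element `a + b τ` of `ℤ[τ]` attached to a pair `(a, b)`. -/
def grPair (p : ℤ × ℤ) : ℝ := p.1 + p.2 * gr

/-- The rational part of the square of `a + b τ`. -/
def sqFst (p : ℤ × ℤ) : ℤ := p.1 ^ 2 + p.2 ^ 2

/-- The coefficient of `τ` in the square of `a + b τ`. -/
def sqSnd (p : ℤ × ℤ) : ℤ := 2 * p.1 * p.2 + p.2 ^ 2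

theorem grPair_sq (p : ℤ × ℤ) : grPair p ^ 2 = sqFst p + sqSnd p * gr := by
  simp only [grPair, sqFst, sqSnd]
  push_cast
  linear_combination (p.2 : ℝ) ^ 2 * gr_sq

theorem exists_shortPair (p : ℤ × ℤ) (h : sqFst p ≤ 4) :
    ∃ k, p = shortPair k ∨ p = -shortPair k := by
  obtain ⟨a, b⟩ := p
  simp only [sqFst] at h
  have ha : a ∈ Finset.Icc (-2) 2 := by
    rw [Finset.mem_Icc]
    constructor <;> nlinarith [sq_nonneg b]
  have hb : b ∈ Finset.Icc (-2) 2 := by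
    rw [Finset.mem_Icc]
    constructor <;> nlinarith [sq_nonneg a]
  have key : ∀ a ∈ Finset.Icc (-2 : ℤ) 2, ∀ b ∈ Finset.Icc (-2 : ℤ) 2, a ^ 2 + b ^ 2 ≤ 4 →
      ∃ k, (a, b) = shortPair k ∨ (a, b) = -shortPair k := by
    decide +kernel
  exact key a ha b hb h

theorem shortPair_classification (f : Fin 4 → Fin 7)
    (h₁ : ∑ i, sqFst (shortPair (f i)) = 4) (h₂ : ∑ i, sqSnd (shortPair (f i)) = 0) :
    (∃ i, f i = 5 ∧ ∀ j, j ≠ i → f j = 0) ∨ (∀ i, f i = 1) ∨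
      ∃ σ : Equiv.Perm (Fin 4), Equiv.Perm.sign σ = 1 ∧
        ((∀ i, f i = ![0, 1, 4, 2] (σ i)) ∨ ∀ i, f i = ![0, 1, 2, 4] (σ i)) := by
  have key : ∀ a b c d : Fin 7,
      ∑ i, sqFst (shortPair (![a, b, c, d] i)) = 4 →
      ∑ i, sqSnd (shortPair (![a, b, c, d] i)) = 0 →
      (∃ i, ![a, b, c, d] i = 5 ∧ ∀ j, j ≠ i → ![a, b, c, d] j = 0) ∨
      (∀ i, ![a, b, c, d] i = 1) ∨
      ∃ σ : Equiv.Perm (Fin 4), Equiv.Perm.sign σ = 1 ∧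
        ((∀ i, ![a, b, c, d] i = ![0, 1, 4, 2] (σ i)) ∨
          ∀ i, ![a, b, c, d] i = ![0, 1, 2, 4] (σ i)) := by
    decide +kernel
  have hf : f = ![f 0, f 1, f 2, f 3] := by
    ext i
    fin_cases i <;> rfl
  rw [hf] at h₁ h₂ ⊢
  exact key _ _ _ _ h₁ h₂

theorem mem_DeltaSet_of_sum_sq {x : Fin 4 → ℝ} (hs : ∑ i, x i ^ 2 = 1)
    (hx : ∀ i, 2 * x i ∈ Ztau) : x ∈ DeltaSet gr ∪ DeltaSet (1 - gr) := by
  have hp : ∀ i, ∃ p : ℤ × ℤ, 2 * x i = grPair p := fun i ↦ by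
    obtain ⟨a, b, h⟩ := hx i
    exact ⟨(a, b), h⟩
  choose p hp using hp
  have hsum : ∑ i, grPair (p i) ^ 2 = 4 := by
    simp_rw [← hp, mul_pow, ← Finset.mul_sum, hs]
    norm_num
  have hzero : ((∑ i, sqFst (p i) - 4 : ℤ) : ℝ) + (∑ i, sqSnd (p i) : ℤ) * gr = 0 := by
    simp_rw [grPair_sq, Finset.sum_add_distrib, ← Finset.sum_mul] at hsum
    push_cast
    linarith
  obtain ⟨h₁, h₂⟩ := int_add_mul_gr_eq_zero hzero
  have hle : ∀ i, sqFst (p i) ≤ 4 := fun i ↦ by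
    have := Finset.single_le_sum (f := fun i ↦ sqFst (p i))
      (fun i _ ↦ add_nonneg (sq_nonneg (p i).1) (sq_nonneg (p i).2)) (Finset.mem_univ i)
    linarith
  choose f hf using fun i ↦ exists_shortPair (p i) (hle i)
  have hfst : ∀ i, sqFst (p i) = sqFst (shortPair (f i)) := fun i ↦ by
    rcases hf i with h | h <;> simp [h, sqFst]
  have hsnd : ∀ i, sqSnd (p i) = sqSnd (shortPair (f i)) := fun i ↦ by
    rcases hf i with h | h <;> simp [h, sqSnd]
  have hsign : ∀ i, ∃ ε : ℝ, (ε = 1 ∨ ε = -1) ∧ x i = ε * grPair (shortPair (f i)) / 2 := fun i ↦ by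
    have h2 := hp i
    rcases hf i with h | h
    · exact ⟨1, .inl rfl, by rw [← h]; linarith⟩
    · refine ⟨-1, .inr rfl, ?_⟩
      rw [h] at h2
      simp only [grPair, Prod.fst_neg, Prod.snd_neg, Int.cast_neg] at h2 ⊢
      linarith
  choose ε hε hxε using hsign
  simp_rw [hfst] at h₁
  simp_rw [hsnd] at h₂
  rcases shortPair_classification f (by linarith) h₂ with
    ⟨i, hi, hj⟩ | h | ⟨σ, hσ, h | h⟩
  · refine .inl (.inl ⟨i, ?_, fun j hji ↦ ?_⟩)
    · rw [hxε, hi]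
      rcases hε i with h | h <;> simp [h, grPair, shortPair]
    · rw [hxε, hj j hji]
      simp [grPair, shortPair]
  · refine .inl (.inr (.inl fun i ↦ ?_))
    rw [hxε, h]
    rcases hε i with h | h <;> simp [h, grPair, shortPair]
  · refine .inl (.inr (.inr ⟨σ, hσ, ε, hε, fun i ↦ ?_⟩))
    rw [hxε, h]
    congr 2
    generalize σ i = k
    fin_cases k <;> simp [grPair, shortPair, sub_eq_add_neg]
  · refine .inr (.inr (.inr ⟨σ, hσ, ε, hε, fun i ↦ ?_⟩))
    rw [hxε, h]
    congr 2
    generalize σ i = k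
    fin_cases k <;> simp [grPair, shortPair, sub_eq_add_neg]

theorem sum_sq_of_mem_DeltaSet {t : ℝ} (ht : t ^ 2 = t + 1) {x : Fin 4 → ℝ}
    (hx : x ∈ DeltaSet t) : ∑ i, x i ^ 2 = 1 := by
  rcases hx with ⟨i, hi, hj⟩ | h | ⟨σ, -, ε, hε, h⟩
  · rw [Finset.sum_eq_single i (fun j _ hji ↦ by simp [hj j hji]) (by simp)]
    rcases hi with h | h <;> simp [h]
  · have hsq : ∀ i, x i ^ 2 = 1 / 4 := fun i ↦ by
      rcases h i with h | h <;> norm_num [h]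
    simp [hsq]
  · have hsq : ∀ i, x i ^ 2 = (![0, 1, 1 - t, t] (σ i) / 2) ^ 2 := fun i ↦ by
      rw [h]
      rcases hε i with h | h <;> rw [h] <;> ring
    simp_rw [hsq]
    rw [Equiv.sum_comp σ fun k ↦ (![0, 1, 1 - t, t] k / 2) ^ 2]
    simp only [Fin.sum_univ_four, Matrix.cons_val]
    linear_combination ht / 2

theorem two_mul_mem_Ztau_of_mem_DeltaSet {t : ℝ} (ht : t ∈ Ztau) {x : Fin 4 → ℝ}
    (hx : x ∈ DeltaSet t) (i : Fin 4) : 2 * x i ∈ Ztau := by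
  have hint : ∀ n : ℤ, (n : ℝ) ∈ Ztau := fun n ↦ ⟨n, 0, by simp⟩
  rcases hx with ⟨k, hk, hj⟩ | h | ⟨σ, -, ε, hε, h⟩
  · by_cases hik : i = k
    · subst hik
      rcases hk with h | h
      · simpa [h] using hint 2
      · simpa [h] using hint (-2)
    · simpa [hj i hik] using hint 0
  · rcases h i with h | h
    · simpa [h] using hint 1
    · convert hint (-1) using 1
      norm_num [h]
  · have hv : ∀ k, ![0, 1, 1 - t, t] k ∈ Ztau := by
      obtain ⟨a, b, hab⟩ := ht
      intro k
      fin_cases k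
      · simpa using hint 0
      · simpa using hint 1
      · exact ⟨1 - a, -b, by simp [hab]; ring⟩
      · exact ⟨a, b, hab⟩
    rw [h]
    rcases hε i with h | h
    · convert hv (σ i) using 1
      rw [h]; ring
    · convert neg_mem_Ztau (hv (σ i)) using 1
      rw [h]; ring

theorem statement0 (x : Fin 4 → ℝ) :
    ((∑ i, x i ^ 2) = 1 ∧ ∀ i, 2 * x i ∈ Ztau) ↔
      x ∈ DeltaSet gr ∪ DeltaSet (1 - gr) := by
  constructor
  · rintro ⟨hs, hx⟩
    exact mem_DeltaSet_of_sum_sq hs hx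
  · rintro (hx | hx)
    · have ht : gr ∈ Ztau := ⟨0, 1, by simp⟩
      exact ⟨sum_sq_of_mem_DeltaSet gr_sq hx, two_mul_mem_Ztau_of_mem_DeltaSet ht hx⟩
    · have ht : 1 - gr ∈ Ztau := ⟨1, -1, by simp [sub_eq_add_neg]⟩
      have hsq : (1 - gr) ^ 2 = (1 - gr) + 1 := by linear_combination gr_sq
      exact ⟨sum_sq_of_mem_DeltaSet hsq hx, two_mul_mem_Ztau_of_mem_DeltaSet ht hx⟩
end
end

section
/- If x = (x₁,x₂,x₃,x₄) ∈ ℤ[τ]⁴ satisfies x₁² + x₂² + x₃² + x₄² ≡ 0 (mod 4ℤ[τ]), then exactly one of the following holds: (1) every xᵢ ≡ 0 (mod 2ℤ[τ]); (2) all the xᵢ are congruent to each other modulo 2ℤ[τ] but not congruent to 0; (3) (x₁,x₂,x₃,x₄) is congruent modulo 2ℤ[τ]⁴ to some permutation of the components of (0,1,τ',τ). -/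
noncomputable section

/-- Congruence modulo 2ℤ[τ]. -/
def cong2 (x y : ℝ) : Prop := ∃ a b : ℤ, x - y = 2 * ((a : ℝ) + (b : ℝ) * gr)

/-- Congruence modulo 4ℤ[τ]. -/
def cong4 (x y : ℝ) : Prop := ∃ a b : ℤ, x - y = 4 * ((a : ℝ) + (b : ℝ) * gr)

theorem int_add_int_mul_gr_eq_zero {a b : ℤ} (h : (a : ℝ) + (b : ℝ) * gr = 0) :
    a = 0 ∧ b = 0 := by
  have hb : b = 0 := by
    by_contra hb
    have hirr : Irrational ((b : ℝ) * gr) :=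
      (show Irrational gr from Real.goldenRatio_irrational).intCast_mul hb
    exact hirr.ne_int (-a) (by push_cast; linarith)
  subst hb
  simpa using h

theorem cong2_symm {x y : ℝ} : cong2 x y → cong2 y x := by
  rintro ⟨a, b, h⟩
  exact ⟨-a, -b, by push_cast; linarith⟩

theorem cong2_trans {x y z : ℝ} : cong2 x y → cong2 y z → cong2 x z := by
  rintro ⟨a, b, h⟩ ⟨c, d, h'⟩
  exact ⟨a + c, b + d, by push_cast; linarith⟩

/-- Congruent elements modulo 2 have congruent squares modulo 4. -/
theorem cong4_sq_of_cong2 {x y : ℝ} (hy : y ∈ Ztau) : cong2 x y → cong4 (y ^ 2) (x ^ 2) := by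
  obtain ⟨c, d, rfl⟩ := hy
  rintro ⟨a, b, h⟩
  obtain rfl : x = c + d * gr + 2 * (a + b * gr) := by linarith
  refine ⟨-(a * (c + a) + b * (d + b)), -(a * (d + b) + b * (c + a) + b * (d + b)), ?_⟩
  push_cast
  linear_combination (-4 * b * (d + b) : ℝ) * gr_sq

theorem cong2_int_add_int_mul_gr_iff {a b c d : ℤ} :
    cong2 ((a : ℝ) + (b : ℝ) * gr) ((c : ℝ) + (d : ℝ) * gr) ↔ 2 ∣ a - c ∧ 2 ∣ b - d := by
  constructor
  · rintro ⟨k, l, h⟩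
    obtain ⟨h₁, h₂⟩ := int_add_int_mul_gr_eq_zero (a := a - c - 2 * k) (b := b - d - 2 * l)
      (by push_cast; linarith)
    exact ⟨⟨k, by omega⟩, ⟨l, by omega⟩⟩
  · rintro ⟨⟨k, hk⟩, ⟨l, hl⟩⟩
    refine ⟨k, l, ?_⟩
    have hk' : (a : ℝ) - c = 2 * k := by exact_mod_cast hk
    have hl' : (b : ℝ) - d = 2 * l := by exact_mod_cast hl
    linear_combination hk' + gr * hl'

/-- The representative `0, 1, 1 - τ, τ` in coordinates with respect to the basis `1, τ`. -/
theorem rep_eq (j : Fin 4) : (![0, 1, 1 - gr, gr] : Fin 4 → ℝ) j =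
    ((![0, 1, 1, 0] : Fin 4 → ℤ) j : ℝ) + ((![0, 0, -1, 1] : Fin 4 → ℤ) j : ℝ) * gr := by
  fin_cases j <;> simp [sub_eq_add_neg]

theorem rep_sq_eq (j : Fin 4) : (![0, 1, 1 - gr, gr] : Fin 4 → ℝ) j ^ 2 =
    ((![0, 1, 2, 1] : Fin 4 → ℤ) j : ℝ) + ((![0, 0, -1, 1] : Fin 4 → ℤ) j : ℝ) * gr := by
  have := gr_sq
  fin_cases j <;> simp <;> linarith

theorem cong2_rep_iff (j k : Fin 4) :
    cong2 ((![0, 1, 1 - gr, gr] : Fin 4 → ℝ) j) ((![0, 1, 1 - gr, gr] : Fin 4 → ℝ) k) ↔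
      j = k := by
  rw [rep_eq, rep_eq, cong2_int_add_int_mul_gr_iff]
  revert j k
  decide

theorem exists_cong2_rep {x : ℝ} (hx : x ∈ Ztau) :
    ∃ j, cong2 x ((![0, 1, 1 - gr, gr] : Fin 4 → ℝ) j) := by
  obtain ⟨a, b, rfl⟩ := hx
  simp only [rep_eq, cong2_int_add_int_mul_gr_iff, Fin.exists_fin_succ]
  simp
  omega

/-- Four residues modulo 2 whose squares sum to 0 modulo 4 are all equal or all distinct. -/
theorem residues_eq_or_injective (c : Fin 4 → Fin 4)
    (h₁ : 4 ∣ ∑ i, (![0, 1, 2, 1] : Fin 4 → ℤ) (c i))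
    (h₂ : 4 ∣ ∑ i, (![0, 0, -1, 1] : Fin 4 → ℤ) (c i)) :
    (∀ i j, c i = c j) ∨ Function.Injective c := by
  revert c
  decide +kernel

theorem statement2 (x : Fin 4 → ℝ) (hx : ∀ i, x i ∈ Ztau)
    (h : cong4 (∑ i, x i ^ 2) 0) :
    (((∀ i, cong2 (x i) 0) ∨
      ((∀ i j, cong2 (x i) (x j)) ∧ ∀ i, ¬ cong2 (x i) 0) ∨
      (∃ σ : Equiv.Perm (Fin 4), ∀ i, cong2 (x i) (![0, 1, 1 - gr, gr] (σ i)))) ∧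
     ¬ ((∀ i, cong2 (x i) 0) ∧
        ((∀ i j, cong2 (x i) (x j)) ∧ ∀ i, ¬ cong2 (x i) 0)) ∧
     ¬ ((∀ i, cong2 (x i) 0) ∧
        (∃ σ : Equiv.Perm (Fin 4), ∀ i, cong2 (x i) (![0, 1, 1 - gr, gr] (σ i)))) ∧
     ¬ (((∀ i j, cong2 (x i) (x j)) ∧ ∀ i, ¬ cong2 (x i) 0) ∧
        (∃ σ : Equiv.Perm (Fin 4), ∀ i, cong2 (x i) (![0, 1, 1 - gr, gr] (σ i))))) := by
  choose c hc using fun i => exists_cong2_rep (hx i)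
  have hrep (i k : Fin 4) : cong2 (x i) ((![0, 1, 1 - gr, gr] : Fin 4 → ℝ) k) ↔ c i = k :=
    ⟨fun hk => (cong2_rep_iff _ _).1 (cong2_trans (cong2_symm (hc i)) hk), fun hk => hk ▸ hc i⟩
  have hzero (i : Fin 4) : cong2 (x i) 0 ↔ c i = 0 := hrep i 0
  have hpair (i j : Fin 4) : cong2 (x i) (x j) ↔ c i = c j :=
    ⟨fun hij => (hrep i _).1 (cong2_trans hij (hc j)),
      fun hij => cong2_trans ((hrep i _).2 hij) (cong2_symm (hc j))⟩
  have hsq (i : Fin 4) := cong4_sq_of_cong2 (hx i) (cong2_symm (hc i))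
  have hc' : (∀ i j, c i = c j) ∨ Function.Injective c := by
    obtain ⟨a, b, hab⟩ := h
    choose k l hkl using hsq
    have hsum : ∑ i, (![0, 1, 1 - gr, gr] : Fin 4 → ℝ) (c i) ^ 2 =
        4 * (((a - ∑ i, k i : ℤ) : ℝ) + ((b - ∑ i, l i : ℤ) : ℝ) * gr) := by
      have := Finset.sum_congr (rfl : (Finset.univ : Finset (Fin 4)) = _) fun i _ => hkl i
      rw [Finset.sum_sub_distrib, ← Finset.mul_sum, Finset.sum_add_distrib,
        ← Finset.sum_mul] at this
      push_cast
      linarith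
    simp only [rep_sq_eq, Finset.sum_add_distrib, ← Finset.sum_mul] at hsum
    obtain ⟨h₁, h₂⟩ := int_add_int_mul_gr_eq_zero
      (a := ∑ i, (![0, 1, 2, 1] : Fin 4 → ℤ) (c i) - 4 * (a - ∑ i, k i))
      (b := ∑ i, (![0, 0, -1, 1] : Fin 4 → ℤ) (c i) - 4 * (b - ∑ i, l i))
      (by push_cast at hsum ⊢; linarith)
    exact residues_eq_or_injective c ⟨_, sub_eq_zero.1 h₁⟩ ⟨_, sub_eq_zero.1 h₂⟩
  simp only [hrep, hzero, hpair]
  have hne (σ : Equiv.Perm (Fin 4)) (hσ : ∀ i, c i = σ i) : c 0 ≠ c 1 := by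
    rw [hσ, hσ]
    exact σ.injective.ne (by decide)
  refine ⟨?_, fun ⟨h0, _, h1⟩ => h1 0 (h0 0),
    fun ⟨h0, σ, hσ⟩ => hne σ hσ ((h0 0).trans (h0 1).symm),
    fun ⟨⟨hall, _⟩, σ, hσ⟩ => hne σ hσ (hall 0 1)⟩
  rcases hc' with hall | hinj
  · by_cases h0 : c 0 = 0
    · exact Or.inl fun i => (hall i 0).trans h0
    · exact Or.inr (Or.inl ⟨hall, fun i hi => h0 ((hall 0 i).trans hi)⟩)
  · exact Or.inr (Or.inr ⟨Equiv.ofBijective c hinj.bijective_of_finite, fun _ => rfl⟩)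
end
end

section
/- If x = (x₁,x₂,x₃) ∈ ℤ[τ]³ satisfies x₁² + x₂² + x₃² ≡ 0 (mod 4ℤ[τ]), then either every xᵢ ≡ 0 (mod 2ℤ[τ]), or (x₁,x₂,x₃) is congruent modulo 2ℤ[τ]³ to some permutation of the components of (1,τ',τ). -/
noncomputable section

theorem irrational_gr : Irrational gr := Real.goldenRatio_irrational

theorem intCast_add_mul_gr_inj {a b c d : ℤ}
    (h : (a : ℝ) + b * gr = c + d * gr) : a = c ∧ b = d := by
  have hbd : b = d := by
    by_contra hne
    refine (irrational_gr.intCast_mul (sub_ne_zero.mpr hne)).ne_int (c - a) ?_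
    push_cast
    linear_combination h
  subst hbd
  exact ⟨by exact_mod_cast add_right_cancel h, rfl⟩

theorem exists_eq_two_mul_add_fin (a : ℤ) : ∃ (k : ℤ) (r : Fin 2), a = 2 * k + (r : ℕ) := by
  rcases Int.even_or_odd' a with ⟨k, rfl | rfl⟩
  · exact ⟨k, 0, by simp⟩
  · exact ⟨k, 1, by simp⟩

/-- The classification of the residues modulo 2, a residue `r + sτ` being written `(r, s)`. -/
theorem residues_of_sum_sq_eq_zero : ∀ p : Fin 3 → Fin 2 × Fin 2,
    ∑ i, (((p i).1 : ℕ) ^ 2 + ((p i).2 : ℕ) ^ 2 : ZMod 4) = 0 →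
    ∑ i, (2 * ((p i).1 : ℕ) * ((p i).2 : ℕ) + ((p i).2 : ℕ) ^ 2 : ZMod 4) = 0 →
    (∀ i, p i = (0, 0)) ∨
      ∃ σ : Equiv.Perm (Fin 3), ∀ i, p i = ![(1, 0), (1, 1), (0, 1)] (σ i) := by
  decide

theorem statement3 (x : Fin 3 → ℝ) (hx : ∀ i, x i ∈ Ztau)
    (h : cong4 (∑ i, x i ^ 2) 0) :
    (∀ i, cong2 (x i) 0) ∨
      (∃ σ : Equiv.Perm (Fin 3), ∀ i, cong2 (x i) (![1, 1 - gr, gr] (σ i))) := by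
  choose a b hab using hx
  choose k r hr using fun i => exists_eq_two_mul_add_fin (a i)
  choose l s hs using fun i => exists_eq_two_mul_add_fin (b i)
  obtain ⟨c, d, hcd⟩ := h
  have hsum : ((∑ i, (a i ^ 2 + b i ^ 2) : ℤ) : ℝ) +
      ((∑ i, (2 * a i * b i + b i ^ 2) : ℤ) : ℝ) * gr =
      ((4 * c : ℤ) : ℝ) + ((4 * d : ℤ) : ℝ) * gr := by
    simp only [hab, Fin.sum_univ_three] at hcd ⊢
    push_cast
    linear_combination hcd - (b 0 ^ 2 + b 1 ^ 2 + b 2 ^ 2 : ℝ) * gr_sq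
  obtain ⟨h₁, h₂⟩ := intCast_add_mul_gr_inj hsum
  have four : (4 : ZMod 4) = 0 := rfl
  have key := residues_of_sum_sq_eq_zero (fun i => (r i, s i)) (by
      have := congrArg (Int.cast : ℤ → ZMod 4) h₁
      simp only [hr, hs, Fin.sum_univ_three] at this ⊢
      push_cast at this
      linear_combination this + (c - ∑ i, ((k i : ZMod 4) ^ 2 + k i * (r i : ℕ)
        + l i ^ 2 + l i * (s i : ℕ))) * four
        + 4 * (Fin.sum_univ_three fun i => (k i : ZMod 4) ^ 2 + k i * (r i : ℕ)
        + l i ^ 2 + l i * (s i : ℕ)))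
    (by
      have := congrArg (Int.cast : ℤ → ZMod 4) h₂
      simp only [hr, hs, Fin.sum_univ_three] at this ⊢
      push_cast at this
      linear_combination this + (d - ∑ i, (2 * (k i : ZMod 4) * l i + k i * (s i : ℕ)
        + l i * (r i : ℕ) + l i ^ 2 + l i * (s i : ℕ))) * four
        + 4 * (Fin.sum_univ_three fun i => 2 * (k i : ZMod 4) * l i + k i * (s i : ℕ)
        + l i * (r i : ℕ) + l i ^ 2 + l i * (s i : ℕ)))
  refine key.imp (fun h0 i => ?_) (fun ⟨σ, hσ⟩ => ⟨σ, fun i => ?_⟩)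
  · obtain ⟨hri, hsi⟩ := Prod.mk.inj (h0 i)
    refine ⟨k i, l i, ?_⟩
    rw [hab, hr, hs, hri, hsi]
    push_cast
    simp
    ring
  · have hi := hσ i
    generalize σ i = j at hi ⊢
    fin_cases j <;> obtain ⟨hri, hsi⟩ := Prod.mk.inj hi
    · refine ⟨k i, l i, ?_⟩
      rw [hab, hr, hs, hri, hsi]
      simp
      ring
    · refine ⟨k i, l i + 1, ?_⟩
      rw [hab, hr, hs, hri, hsi]
      simp
      ring
    · refine ⟨k i, l i, ?_⟩
      rw [hab, hr, hs, hri, hsi]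
      simp
      ring
end
end

section
/- For all α ∈ Δ̇ and all β' ∈ Δ̇', the composite orthogonal transformation r_α ∘ r_{β'} of ℝ⁴ has infinite order (no positive power of it is the identity). -/
noncomputable section

/-- K = Δ ∩ Δ', the rational roots. -/
def Kset : Set (Fin 4 → ℝ) := DeltaSet gr ∩ DeltaSet (1 - gr)

/-- The orthogonal reflection in the hyperplane orthogonal to the unit vector `a`:
`x ↦ x - 2(x·a)a`. -/
def reflv (a x : Fin 4 → ℝ) : Fin 4 → ℝ := fun i => x i - 2 * (∑ j, x j * a j) * a i

/-- The ring `ℤ[τ]`, presented abstractly. -/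
abbrev GoldenInt := QuadraticAlgebra ℤ 1 1

/-- The field with four elements, as the reduction of `ℤ[τ]` modulo `2`. -/
abbrev GoldenMod := QuadraticAlgebra (ZMod 2) 1 1

namespace GoldenInt

/-- The embedding `ℤ[τ] → ℝ`. -/
def toReal : GoldenInt →ₐ[ℤ] ℝ :=
  QuadraticAlgebra.lift ⟨gr, by have := gr_sq; simp; linarith⟩

/-- Reduction modulo `2`. -/
def toMod : GoldenInt →ₐ[ℤ] GoldenMod :=
  QuadraticAlgebra.lift ⟨⟨0, 1⟩, by simp; decide⟩

/-- The golden ratio as an element of `ℤ[τ]`. -/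
def tau : GoldenInt := ⟨0, 1⟩

theorem toReal_tau : toReal tau = gr := by
  simp [toReal, tau, QuadraticAlgebra.lift]

theorem toMod_tau : toMod tau = ⟨0, 1⟩ := by
  simp [toMod, tau, QuadraticAlgebra.lift]

theorem toMod_four : toMod 4 = 0 := by
  rw [map_ofNat]; decide

theorem toReal_injective : Function.Injective toReal := by
  refine (injective_iff_map_eq_zero toReal).2 fun x hx => ?_
  have h : (x.re : ℝ) + x.im * gr = 0 := by
    simpa [toReal, QuadraticAlgebra.lift] using hx
  have him : x.im = 0 := by
    by_contra hne
    refine Real.goldenRatio_irrational ⟨-x.re / x.im, ?_⟩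
    have hne' : (x.im : ℝ) ≠ 0 := by exact_mod_cast hne
    change _ = gr
    push_cast
    field_simp
    linarith
  have hre : x.re = 0 := by
    rw [him] at h
    simpa using h
  exact QuadraticAlgebra.ext hre him

end GoldenInt

open GoldenInt

/-- For an odd permutation `f` of the field `𝔽₄`, the sum `∑ u * f u` is a unit. -/
theorem goldenMod_pairing (π : Equiv.Perm (Fin 4)) (hπ : Equiv.Perm.sign π = 1) :
    (∑ i, (![0, 1, 1 - ⟨0, 1⟩, ⟨0, 1⟩] : Fin 4 → GoldenMod) i *
      (![0, 1, 1 - (1 - ⟨0, 1⟩), 1 - ⟨0, 1⟩] : Fin 4 → GoldenMod) (π i)) ^ 3 = 1 := by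
  revert π
  decide

/-- A nonrational root has unit length, and its double lifts to `ℤ[τ]`, with known reduction
modulo `2`. -/
theorem exists_lift_of_mem {θ θ' : GoldenInt} (hθ : toReal θ ^ 2 = toReal θ + 1)
    {x : Fin 4 → ℝ} (hx : x ∈ DeltaSet (toReal θ)) (hx' : x ∉ DeltaSet (toReal θ')) :
    (∑ i, x i * x i = 1) ∧ ∃ σ : Equiv.Perm (Fin 4), Equiv.Perm.sign σ = 1 ∧
      ∃ v : Fin 4 → GoldenInt, (∀ i, toReal (v i) = 2 * x i) ∧
        ∀ i, toMod (v i) = (![0, 1, 1 - toMod θ, toMod θ] : Fin 4 → GoldenMod) (σ i) := by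
  obtain h | h | ⟨σ, hσ, ε, hε, h⟩ := hx
  · exact absurd (Or.inl h) hx'
  · exact absurd (Or.inr (Or.inl h)) hx'
  have hε2 (i) : ε i * ε i = 1 := by
    obtain h | h := hε i <;> rw [h] <;> norm_num
  refine ⟨?_, σ, hσ, ?_⟩
  · have h2 (i) : x i * x i = (![0, 1, 1 - toReal θ, toReal θ] (σ i)) ^ 2 / 4 := by
      rw [h i]
      linear_combination (![0, 1, 1 - toReal θ, toReal θ] (σ i)) ^ 2 / 4 * hε2 i
    simp_rw [h2]
    rw [Equiv.sum_comp σ (fun i => (![0, 1, 1 - toReal θ, toReal θ] i) ^ 2 / 4)]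
    simp only [Fin.sum_univ_four, Matrix.cons_val]
    linear_combination hθ / 2
  · have hs (i) : ∃ s : GoldenInt, toReal s = ε i ∧ toMod s = 1 := by
      obtain h | h := hε i
      · exact ⟨1, by simp [h], by simp⟩
      · exact ⟨-1, by simp [h], by rw [map_neg, map_one]; decide⟩
    choose s hs hs' using hs
    refine ⟨fun i => s i * ![0, 1, 1 - θ, θ] (σ i), fun i => ?_, fun i => ?_⟩
    · rw [map_mul, hs, h]
      generalize σ i = j
      fin_cases j <;> simp <;> ring
    · rw [map_mul, hs', one_mul]
      generalize σ i = j
      fin_cases j <;> simp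

theorem reflv_dot (a x y : Fin 4 → ℝ) :
    ∑ i, reflv a x i * y i = ∑ i, x i * y i - 2 * (∑ i, x i * a i) * ∑ i, a i * y i := by
  simp only [reflv, sub_mul, Finset.sum_sub_distrib, Finset.mul_sum, mul_assoc]

/-- Scaled inner products of the orbit of `α` under `r_α ∘ r_β` with `α` and `β` lie in `ℤ[τ]`;
modulo `2` the latter is an odd power of `4 α·β`. -/
theorem exists_lift_iterate {α β : Fin 4 → ℝ} (hα : ∑ i, α i * α i = 1) (hβ : ∑ i, β i * β i = 1)
    {c : GoldenInt} (hc : toReal c = 4 * ∑ i, α i * β i) (k : ℕ) :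
    ∃ P Q : GoldenInt,
      toReal P = 2 * 4 ^ k * ∑ i, (reflv α ∘ reflv β)^[k] α i * α i ∧
      toReal Q = 4 ^ (k + 1) * ∑ i, (reflv α ∘ reflv β)^[k] α i * β i ∧
      toMod Q = toMod c ^ (2 * k + 1) := by
  induction k with
  | zero => exact ⟨2, c, by rw [map_ofNat]; simp [hα], by simp [hc], by simp⟩
  | succ k ih =>
    obtain ⟨P, Q, hP, hQ, hQ'⟩ := ih
    have hβα : ∑ i, β i * α i = ∑ i, α i * β i := by simp_rw [mul_comm]
    refine ⟨-4 * P + c * Q, (c ^ 2 - 4) * Q - 4 * c * P, ?_, ?_, ?_⟩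
    · rw [Function.iterate_succ_apply', Function.comp_apply]
      simp only [reflv_dot, hα, hβα, map_add, map_mul, map_neg, map_ofNat, hP, hQ, hc]
      ring
    · rw [Function.iterate_succ_apply', Function.comp_apply]
      simp only [reflv_dot, hβ, hβα, map_sub, map_mul, map_pow, map_ofNat, hP, hQ, hc]
      ring
    · simp only [map_sub, map_mul, map_pow, toMod_four, hQ']
      ring

theorem statement6 (α β : Fin 4 → ℝ) (hα : α ∈ DeltaSet gr \ Kset)
    (hβ : β ∈ DeltaSet (1 - gr) \ Kset) :
    ∀ k : ℕ, 0 < k → (reflv α ∘ reflv β)^[k] ≠ id := by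
  intro k hk hid
  have hτ := toReal_tau
  have hτ' : toReal (1 - tau) = 1 - gr := by rw [map_sub, map_one, hτ]
  have hα' : α ∉ DeltaSet (1 - gr) := fun h => hα.2 ⟨hα.1, h⟩
  have hβ' : β ∉ DeltaSet gr := fun h => hβ.2 ⟨h, hβ.1⟩
  obtain ⟨hα1, σ, hσ, v, hv, hv'⟩ := exists_lift_of_mem (θ := tau) (θ' := 1 - tau) (x := α)
    (by rw [hτ, gr_sq]) (by rw [hτ]; exact hα.1) (by rwa [hτ'])
  obtain ⟨hβ1, ρ, hρ, w, hw, hw'⟩ := exists_lift_of_mem (θ := 1 - tau) (θ' := tau) (x := β)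
    (by rw [hτ']; linear_combination gr_sq) (by rw [hτ']; exact hβ.1) (by rwa [hτ])
  set c := ∑ i, v i * w i with hcdef
  have hc : toReal c = 4 * ∑ i, α i * β i := by
    rw [hcdef, map_sum, Finset.mul_sum]
    refine Finset.sum_congr rfl fun i _ => ?_
    rw [map_mul, hv, hw]
    ring
  have hc3 : toMod c ^ 3 = 1 := by
    rw [← goldenMod_pairing (ρ * σ⁻¹) (by simp [hσ, hρ]), hcdef, map_sum]
    congr 1
    refine Fintype.sum_equiv σ _ _ fun i => ?_
    simp [hv', hw', toMod_tau]
  obtain ⟨P, Q, -, hQ, hQ'⟩ := exists_lift_iterate hα1 hβ1 hc k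
  have hQc : Q = 4 ^ k * c := by
    apply toReal_injective
    rw [hQ, hid, map_mul, map_pow, map_ofNat, hc, id]
    ring
  rw [hQc, map_mul, map_pow, toMod_four, zero_pow hk.ne', zero_mul] at hQ'
  have h1 : (toMod c ^ 3) ^ (2 * k + 1) = 0 := by
    rw [← pow_mul, mul_comm, pow_mul, ← hQ', zero_pow three_ne_zero]
  rw [hc3, one_pow] at h1
  exact absurd h1 (by decide)
end
end
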